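/- Let t ≥ 2, let r = 2t or r = 2t + 1, and let n ≥ 2r. Then for all permutations π, τ of Fin n with d(π, τ) ≥ 2r − 1 there exist permutations π', τ' with d(π', τ') = 2r − 1 and |B_r(π) ∩ B_r(τ)| ≤ |B_r(π') ∩ B_r(τ')|; that is, N(n, 2r−1, r) = I(n, 2r−1, r). Consequently N(n, 2r−1, r) ≥ N(n, 2r, r), and N(n, 2r−1, r) ≥ 2·C(2t−3, t) + ℓ*·C(2t−2, t−1), where ℓ* = 5 if r = 2t and ℓ* = 7 if r = 2t + 1. -/

import Mathlib

/-- The Hamming distance between two permutations of `Fin n`. -/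
def hdist {n : ℕ} (π τ : Equiv.Perm (Fin n)) : ℕ :=
  (Finset.univ.filter fun i => π i ≠ τ i).card

/-- The metric ball of radius `r` centered at `π` for the Hamming distance. -/
def pball {n : ℕ} (π : Equiv.Perm (Fin n)) (r : ℕ) : Finset (Equiv.Perm (Fin n)) :=
  Finset.univ.filter fun σ => hdist π σ ≤ r

/-- `N(n, d, r)`: the maximum of `|B_r(π) ∩ B_r(τ)|` over pairs of permutations of
`Fin n` at Hamming distance at least `d`. -/
def Nmax (n d r : ℕ) : ℕ :=
  (Finset.univ.filter fun p : Equiv.Perm (Fin n) × Equiv.Perm (Fin n) =>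
      d ≤ hdist p.1 p.2).sup fun p => (pball p.1 r ∩ pball p.2 r).card

/-- `I(n, d, r)`: the maximum of `|B_r(π) ∩ B_r(τ)|` over pairs of permutations of
`Fin n` at Hamming distance exactly `d`. -/
def Imax (n d r : ℕ) : ℕ :=
  (Finset.univ.filter fun p : Equiv.Perm (Fin n) × Equiv.Perm (Fin n) =>
      hdist p.1 p.2 = d).sup fun p => (pball p.1 r ∩ pball p.2 r).card

/-- Hamming distance on permutations of a finite type. -/
def hd {α : Type*} [Fintype α] [DecidableEq α] (σ τ : Equiv.Perm α) : ℕ :=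
  (Finset.univ.filter fun i => σ i ≠ τ i).card

theorem hd_eq_zero {α : Type*} [Fintype α] [DecidableEq α] {σ τ : Equiv.Perm α} :
    hd σ τ = 0 ↔ σ = τ := by
  unfold hd
  rw [Finset.card_eq_zero, Finset.filter_eq_empty_iff]
  constructor
  · intro h; ext x; simpa using h (Finset.mem_univ x)
  · rintro rfl x _; simp

theorem hd_via {α β : Type*} [Fintype α] [DecidableEq α] [Fintype β] [DecidableEq β]
    (f : α ↪ β) (σ τ : Equiv.Perm α) :
    hd (σ.viaFintypeEmbedding f) (τ.viaFintypeEmbedding f) = hd σ τ := by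
  unfold hd
  rw [← Finset.card_map f]
  congr 1
  ext y
  simp only [Finset.mem_filter, Finset.mem_univ, true_and, Finset.mem_map]
  constructor
  · intro h
    by_cases hy : y ∈ Set.range f
    · obtain ⟨x, rfl⟩ := hy
      refine ⟨x, ?_, rfl⟩
      simpa [Equiv.Perm.viaFintypeEmbedding_apply_image] using h
    · exact absurd (by
        rw [Equiv.Perm.viaFintypeEmbedding_apply_notMem_range _ _ hy,
          Equiv.Perm.viaFintypeEmbedding_apply_notMem_range _ _ hy]) h
  · rintro ⟨x, hx, rfl⟩
    simpa [Equiv.Perm.viaFintypeEmbedding_apply_image] using hx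

theorem hd_sum {α β : Type*} [Fintype α] [DecidableEq α] [Fintype β] [DecidableEq β]
    (σ τ : Equiv.Perm α) (σ' τ' : Equiv.Perm β) :
    hd (Equiv.Perm.sumCongr σ σ') (Equiv.Perm.sumCongr τ τ') = hd σ τ + hd σ' τ' := by
  unfold hd
  simp only [Finset.card_filter, Fintype.sum_sum_type]
  simp

/-- The product of the two-cycles with index in `S`. -/
def flipP {m : ℕ} (S : Finset (Fin m)) : Equiv.Perm (Fin m × Bool) :=
  Function.Involutive.toPerm (fun p => (p.1, xor p.2 (decide (p.1 ∈ S)))) (by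
    rintro ⟨i, b⟩; simp)

theorem flipP_apply {m : ℕ} (S : Finset (Fin m)) (p : Fin m × Bool) :
    flipP S p = (p.1, xor p.2 (decide (p.1 ∈ S))) := rfl

theorem flipP_inj {m : ℕ} {S T : Finset (Fin m)} (h : flipP S = flipP T) : S = T := by
  ext i
  have := congrArg (fun e => (e (i, false)).2) h
  simpa [flipP_apply] using this

theorem hd_flip_empty {m : ℕ} (S : Finset (Fin m)) : hd (flipP ∅) (flipP S) = 2 * S.card := by
  have : (Finset.univ.filter fun i => flipP ∅ i ≠ flipP S i) = S ×ˢ (Finset.univ : Finset Bool) := by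
    ext ⟨i, b⟩
    cases b <;> simp [flipP_apply]
  unfold hd
  rw [this, Finset.card_product]; simp [mul_comm]

theorem hd_flip_univ {m : ℕ} (S : Finset (Fin m)) :
    hd (flipP Finset.univ) (flipP S) = 2 * Sᶜ.card := by
  have : (Finset.univ.filter fun i => flipP Finset.univ i ≠ flipP S i)
      = Sᶜ ×ˢ (Finset.univ : Finset Bool) := by
    ext ⟨i, b⟩
    cases b <;> simp [flipP_apply]
  unfold hd
  rw [this, Finset.card_product]; simp [mul_comm]

theorem card_compl_eq {m k : ℕ} :
    (Finset.univ.filter fun S : Finset (Fin m) => Sᶜ.card = k).card = m.choose k := by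
  have : (Finset.univ.filter fun S : Finset (Fin m) => Sᶜ.card = k)
      = (Finset.powersetCard k (Finset.univ : Finset (Fin m))).image (fun S => Sᶜ) := by
    ext S
    simp only [Finset.mem_filter, Finset.mem_univ, true_and, Finset.mem_image,
      Finset.mem_powersetCard, Finset.subset_univ]
    constructor
    · intro h; exact ⟨Sᶜ, h, compl_compl S⟩
    · rintro ⟨T, h, rfl⟩; simpa using h
  rw [this, Finset.card_image_of_injective _ compl_injective, Finset.card_powersetCard]
  simp

/-- The lower-bound construction. -/
theorem lower_aux (n t r l p q : ℕ) (ht : 2 ≤ t) (hl : l + 2 * (2 * t - 3) = 2 * r - 1)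
    (hn : 2 * r ≤ n) (ρ : Equiv.Perm (Fin l)) (hρ : hd 1 ρ = l)
    (A B : Finset (Equiv.Perm (Fin l))) (hA : ∀ a ∈ A, hd 1 a = p ∧ hd ρ a = q)
    (hB : ∀ b ∈ B, hd 1 b = q ∧ hd ρ b = p) (hAc : A.card = l) (hBc : B.card = l)
    (h1 : p + 2 * (t - 1) ≤ r) (h2 : q + 2 * (t - 2) ≤ r) (h3 : l + 2 * t ≤ r + 6)
    (h4 : 2 * t ≤ r) (hpq : p ≠ q) (hp : 0 < p) (hq : 0 < q) (hl0 : 0 < l) :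
    ∃ π τ : Equiv.Perm (Fin n), hdist π τ = 2 * r - 1 ∧
      2 * Nat.choose (2 * t - 3) t + l * Nat.choose (2 * t - 2) (t - 1) ≤
        (pball π r ∩ pball τ r).card := by
  classical
  obtain ⟨m, hm⟩ : ∃ m, m = 2 * t - 3 := ⟨_, rfl⟩
  have hf : Nonempty ((Fin l ⊕ (Fin m × Bool)) ↪ Fin n) := by
    apply Function.Embedding.nonempty_of_card_le
    simp; omega
  obtain ⟨f⟩ := hf
  let Φ : Equiv.Perm (Fin l) × Finset (Fin m) → Equiv.Perm (Fin n) := fun x =>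
    (Equiv.Perm.sumCongr x.1 (flipP x.2)).viaFintypeEmbedding f
  have hΦ : ∀ x y, hdist (Φ x) (Φ y) = hd x.1 y.1 + hd (flipP x.2) (flipP y.2) := by
    intro x y
    change hd (Φ x) (Φ y) = _
    rw [hd_via, hd_sum]
  have hinj : Function.Injective Φ := by
    intro x y h
    have h0 := hΦ x y
    rw [h] at h0
    have h00 : hdist (Φ y) (Φ y) = 0 := hd_eq_zero.2 rfl
    rw [h00] at h0
    have e1 := hd_eq_zero.1 (show hd x.1 y.1 = 0 by omega)
    have e2 := flipP_inj (hd_eq_zero.1 (show hd (flipP x.2) (flipP y.2) = 0 by omega))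
    exact Prod.ext e1 e2
  refine ⟨Φ (1, ∅), Φ (ρ, Finset.univ), ?_, ?_⟩
  · rw [hΦ]; simp only
    rw [hρ, hd_flip_empty]; simp; omega
  let T1 := ({1} : Finset (Equiv.Perm (Fin l))) ×ˢ
    (Finset.powersetCard t (Finset.univ : Finset (Fin m)))
  let T2 := ({ρ} : Finset (Equiv.Perm (Fin l))) ×ˢ
    (Finset.univ.filter fun S : Finset (Fin m) => Sᶜ.card = t)
  let T3 := A ×ˢ (Finset.powersetCard (t - 1) (Finset.univ : Finset (Fin m)))
  let T4 := B ×ˢ (Finset.powersetCard (t - 2) (Finset.univ : Finset (Fin m)))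
  have hsymm : hd ρ 1 = l := by
    refine Eq.trans ?_ hρ; unfold hd; simp only [ne_comm]
  have h11 : hd (1 : Equiv.Perm (Fin l)) 1 = 0 := hd_eq_zero.2 rfl
  have hρρ : hd ρ ρ = 0 := hd_eq_zero.2 rfl
  have d12 : Disjoint T1 T2 := by
    apply Finset.disjoint_product.2; left
    simp only [Finset.disjoint_singleton]
    rintro rfl; omega
  have d123 : Disjoint (T1 ∪ T2) T3 := by
    rw [Finset.disjoint_union_left]
    constructor
    · apply Finset.disjoint_product.2; left
      simp only [Finset.disjoint_singleton_left]; intro h; have := hA _ h; omega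
    · apply Finset.disjoint_product.2; left
      simp only [Finset.disjoint_singleton_left]; intro h; have := hA _ h; omega
  have d1234 : Disjoint (T1 ∪ T2 ∪ T3) T4 := by
    rw [Finset.disjoint_union_left, Finset.disjoint_union_left]
    refine ⟨⟨?_, ?_⟩, ?_⟩
    · apply Finset.disjoint_product.2; left
      simp only [Finset.disjoint_singleton_left]; intro h; have := hB _ h; omega
    · apply Finset.disjoint_product.2; left
      simp only [Finset.disjoint_singleton_left]; intro h; have := hB _ h; omega
    · apply Finset.disjoint_product.2; left
      rw [Finset.disjoint_left]; intro a h h'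
      have := hB _ h'; have := hA _ h; omega
  have hcard : (T1 ∪ T2 ∪ T3 ∪ T4).card =
      2 * Nat.choose (2 * t - 3) t + l * Nat.choose (2 * t - 2) (t - 1) := by
    rw [Finset.card_union_of_disjoint d1234, Finset.card_union_of_disjoint d123,
      Finset.card_union_of_disjoint d12]
    simp only [T1, T2, T3, T4, Finset.card_product, Finset.card_singleton,
      Finset.card_powersetCard, card_compl_eq, Finset.card_univ, Fintype.card_fin, hAc, hBc]
    have e1 : 2 * t - 2 = m + 1 := by omega
    have e2 : t - 1 = (t - 2) + 1 := by omega
    rw [e1, e2, Nat.choose_succ_succ, ← hm]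
    ring
  rw [← hcard, ← Finset.card_image_of_injective _ hinj]
  apply Finset.card_le_card
  intro σ hσ
  obtain ⟨⟨a, S⟩, hx, rfl⟩ := Finset.mem_image.1 hσ
  have hc : S.card + Sᶜ.card = m := by rw [Finset.card_add_card_compl]; simp
  simp only [pball, Finset.mem_inter, Finset.mem_filter, Finset.mem_univ, true_and, hΦ,
    hd_flip_empty, hd_flip_univ]
  simp only [T1, T2, T3, T4, Finset.mem_union, Finset.mem_product, Finset.mem_singleton,
    Finset.mem_powersetCard, Finset.subset_univ, true_and, Finset.mem_filter,
    Finset.mem_univ] at hx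
  rcases hx with ((⟨rfl, h⟩ | ⟨rfl, h⟩) | ⟨h', h⟩) | ⟨h', h⟩
  · omega
  · omega
  · have := hA _ h'; omega
  · have := hB _ h'; omega

theorem lower (n t r : ℕ) (ht : 2 ≤ t) (hr : r = 2 * t ∨ r = 2 * t + 1)
    (hn : 2 * r ≤ n) : ∃ π τ : Equiv.Perm (Fin n), hdist π τ = 2 * r - 1 ∧
      2 * Nat.choose (2 * t - 3) t +
        (if r = 2 * t then 5 else 7) * Nat.choose (2 * t - 2) (t - 1) ≤
        (pball π r ∩ pball τ r).card := by
  rcases hr with hr | hr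
  · rw [if_pos hr]
    let a : Fin 5 → Equiv.Perm (Fin 5) := fun i => Equiv.swap i (i + 1)
    let b : Fin 5 → Equiv.Perm (Fin 5) := fun i =>
      Equiv.swap i (i + 1) * Equiv.swap (i + 1) (i + 2) * Equiv.swap (i + 2) (i + 3)
    have ha : ∀ i, hd 1 (a i) = 2 ∧ hd (finRotate 5) (a i) = 4 := by decide +kernel
    have hb : ∀ i, hd 1 (b i) = 4 ∧ hd (finRotate 5) (b i) = 2 := by decide +kernel
    have hai : Function.Injective a := by
      have : ∀ i j, a i = a j → i = j := by decide +kernel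
      exact fun i j => this i j
    have hbi : Function.Injective b := by
      have : ∀ i j, b i = b j → i = j := by decide +kernel
      exact fun i j => this i j
    refine lower_aux n t r 5 2 4 ht (by omega) hn (finRotate 5) (by decide)
      (Finset.univ.image a) (Finset.univ.image b) ?_ ?_ ?_ ?_ (by omega) (by omega) (by omega)
      (by omega) (by omega) (by omega) (by omega) (by omega)
    · simpa using ha
    · simpa using hb
    · rw [Finset.card_image_of_injective _ hai]; simp
    · rw [Finset.card_image_of_injective _ hbi]; simp
  · rw [if_neg (by omega)]
    let a : Fin 7 → Equiv.Perm (Fin 7) := fun i =>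
      Equiv.swap i (i + 1) * Equiv.swap (i + 1) (i + 2)
    let b : Fin 7 → Equiv.Perm (Fin 7) := fun i =>
      Equiv.swap i (i + 1) * Equiv.swap (i + 1) (i + 2) *
        Equiv.swap (i + 2) (i + 3) * Equiv.swap (i + 3) (i + 4)
    have ha : ∀ i, hd 1 (a i) = 3 ∧ hd (finRotate 7) (a i) = 5 := by decide +kernel
    have hb : ∀ i, hd 1 (b i) = 5 ∧ hd (finRotate 7) (b i) = 3 := by decide +kernel
    have hai : Function.Injective a := by
      have : ∀ i j, a i = a j → i = j := by decide +kernel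
      exact fun i j => this i j
    have hbi : Function.Injective b := by
      have : ∀ i j, b i = b j → i = j := by decide +kernel
      exact fun i j => this i j
    refine lower_aux n t r 7 3 5 ht (by omega) hn (finRotate 7) (by decide)
      (Finset.univ.image a) (Finset.univ.image b) ?_ ?_ ?_ ?_ (by omega) (by omega) (by omega)
      (by omega) (by omega) (by omega) (by omega) (by omega)
    · simpa using ha
    · simpa using hb
    · rw [Finset.card_image_of_injective _ hai]; simp
    · rw [Finset.card_image_of_injective _ hbi]; simp

theorem hdist_le_of_perm {n : ℕ} {σ τ σ' τ' : Equiv.Perm (Fin n)} (e : Equiv.Perm (Fin n))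
    (h : ∀ x, σ' x ≠ τ' x → σ (e x) ≠ τ (e x)) : hdist σ' τ' ≤ hdist σ τ := by
  unfold hdist
  apply Finset.card_le_card_of_injOn e
  · intro x hx
    simp only [Finset.coe_filter, Finset.mem_univ, true_and, Set.mem_ofPred_eq] at hx ⊢
    exact h x hx
  · exact e.injective.injOn

theorem hdist_mul {n : ℕ} (u σ τ : Equiv.Perm (Fin n)) :
    hdist (u * σ) (u * τ) = hdist σ τ := by
  unfold hdist; simp

/-- Counting identity: twice-counted positions. -/
theorem hdist_tri {n : ℕ} (σ τ : Equiv.Perm (Fin n)) :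
    hdist 1 τ + (Finset.univ.filter fun x => σ x ≠ x ∧ σ x ≠ τ x).card
      ≤ hdist 1 σ + hdist σ τ := by
  unfold hdist
  simp only [Finset.card_filter]
  rw [← Finset.sum_add_distrib, ← Finset.sum_add_distrib]
  apply Finset.sum_le_sum
  intro x _
  have e1 : (1 : Equiv.Perm (Fin n)) x = x := rfl
  split_ifs <;> grind

theorem mem_two {n r : ℕ} {σ τ : Equiv.Perm (Fin n)} (hτ : hdist 1 τ = 2 * r)
    (h1 : hdist 1 σ ≤ r) (h2 : hdist σ τ ≤ r) (x : Fin n) : σ x = x ∨ σ x = τ x := by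
  have h := hdist_tri σ τ
  have h0 : (Finset.univ.filter fun x => σ x ≠ x ∧ σ x ≠ τ x).card = 0 := by omega
  rw [Finset.card_eq_zero, Finset.filter_eq_empty_iff] at h0
  have := h0 (Finset.mem_univ x)
  tauto

theorem hdist_one_succ {n : ℕ} {τ τ' : Equiv.Perm (Fin n)} (b : Fin n) (hb : τ b ≠ b)
    (h : ∀ x, τ' x ≠ x ↔ (τ x ≠ x ∧ x ≠ b)) : hdist 1 τ' + 1 = hdist 1 τ := by
  unfold hdist
  have : (Finset.univ.filter fun x => (1 : Equiv.Perm (Fin n)) x ≠ τ' x) =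
      (Finset.univ.filter fun x => (1 : Equiv.Perm (Fin n)) x ≠ τ x).erase b := by
    ext x
    simp only [Finset.mem_filter, Finset.mem_univ, true_and, Finset.mem_erase]
    have := h x
    have e1 : (1 : Equiv.Perm (Fin n)) x = x := rfl
    rw [e1, ne_comm, this, ne_comm (a := x) (b := τ x)]; tauto
  rw [this]
  apply Finset.card_erase_add_one
  exact Finset.mem_filter.2 ⟨Finset.mem_univ _, Ne.symm hb⟩

theorem dom_one {n r : ℕ} (τ : Equiv.Perm (Fin n)) (hτ : hdist 1 τ = 2 * r) (hr : 2 ≤ r) :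
    ∃ τ' : Equiv.Perm (Fin n), hdist 1 τ' = 2 * r - 1 ∧
      (pball 1 r ∩ pball τ r).card ≤ (pball 1 r ∩ pball τ' r).card := by
  by_cases hinv : ∀ x, τ (τ x) = x
  · obtain ⟨a, ha⟩ : ∃ a, τ a ≠ a := by
      by_contra! h
      have : hdist 1 τ = 0 := hd_eq_zero.2 (by ext x; simp [h])
      omega
    obtain ⟨b, hb⟩ : ∃ b, τ a = b := ⟨_, rfl⟩
    obtain ⟨c, hc, hca, hcb⟩ : ∃ c, τ c ≠ c ∧ c ≠ a ∧ c ≠ b := by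
      by_contra! h
      have : hdist 1 τ ≤ 2 := by
        unfold hdist
        calc _ ≤ ({a, b} : Finset (Fin n)).card := by
              apply Finset.card_le_card
              intro x hx
              replace hx : x ≠ τ x := (Finset.mem_filter.1 hx).2
              simp only [Finset.mem_insert, Finset.mem_singleton]
              by_cases hxa : x = a
              · exact Or.inl hxa
              · exact Or.inr (h x (Ne.symm hx) hxa)
          _ ≤ 2 := Finset.card_le_two
      omega
    obtain ⟨d, hd'⟩ : ∃ d, τ c = d := ⟨_, rfl⟩
    have hba : τ b = a := by rw [← hb, hinv]
    have hdc : τ d = c := by rw [← hd', hinv]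
    have hab : a ≠ b := by rw [← hb]; exact ha.symm
    have hcd : c ≠ d := by rw [← hd']; exact hc.symm
    have hda : d ≠ a := by rintro rfl; rw [hb] at hdc; exact hcb hdc.symm
    have hdb : d ≠ b := by rintro rfl; rw [hba] at hdc; exact hca hdc.symm
    let u : Equiv.Perm (Fin n) := Equiv.swap a c * Equiv.swap c d
    let v : Equiv.Perm (Fin n) := Equiv.swap b c * Equiv.swap c d
    have ua : u a = c := by simp [u, Equiv.swap_apply_def]; grind
    have uc : u c = d := by simp [u, Equiv.swap_apply_def]; grind
    have ud : u d = a := by simp [u, Equiv.swap_apply_def]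
    have ux : ∀ x, x ≠ a → x ≠ c → x ≠ d → u x = x := by
      intro x h1 h2 h3; simp [u, Equiv.swap_apply_def]; grind
    have vb : v b = c := by simp [v, Equiv.swap_apply_def]; grind
    have vc : v c = d := by simp [v, Equiv.swap_apply_def]; grind
    have vd : v d = b := by simp [v, Equiv.swap_apply_def]
    have vx : ∀ x, x ≠ b → x ≠ c → x ≠ d → v x = x := by
      intro x h1 h2 h3; simp [v, Equiv.swap_apply_def]; grind
    have tx : ∀ x, x ≠ a → x ≠ b → x ≠ c → x ≠ d →
        τ x ≠ a ∧ τ x ≠ b ∧ τ x ≠ c ∧ τ x ≠ d := by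
      intro x h1 h2 h3 h4
      have := hinv x
      refine ⟨?_, ?_, ?_, ?_⟩ <;> intro h <;> rw [h] at this <;> grind
    have ta' : (u * τ) a = b := by
      rw [Equiv.Perm.mul_apply, hb]; exact ux b hab.symm hcb.symm hdb.symm
    have tb' : (u * τ) b = c := by rw [Equiv.Perm.mul_apply, hba, ua]
    have tc' : (u * τ) c = a := by rw [Equiv.Perm.mul_apply, hd', ud]
    have td' : (u * τ) d = d := by rw [Equiv.Perm.mul_apply, hdc, uc]
    have tx' : ∀ x, x ≠ a → x ≠ b → x ≠ c → x ≠ d → (u * τ) x = τ x := by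
      intro x h1 h2 h3 h4
      obtain ⟨g1, g2, g3, g4⟩ := tx x h1 h2 h3 h4
      rw [Equiv.Perm.mul_apply]; exact ux _ g1 g3 g4
    refine ⟨u * τ, ?_, ?_⟩
    · have := hdist_one_succ (τ := τ) (τ' := u * τ) d (by grind) (by
        intro x
        by_cases h1 : x = a
        · subst h1; grind
        by_cases h2 : x = b
        · subst h2; grind
        by_cases h3 : x = c
        · subst h3; grind
        by_cases h4 : x = d
        · subst h4; grind
        rw [tx' x h1 h2 h3 h4]; tauto)
      omega
    · let F : Equiv.Perm (Fin n) → Equiv.Perm (Fin n) := fun σ =>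
        if σ c = c then σ else if σ a = a then v * σ else u * σ
      have key : ∀ σ ∈ pball 1 r ∩ pball τ r, hdist 1 σ ≤ r ∧ hdist σ τ ≤ r ∧
          (∀ x, σ x = x ∨ σ x = τ x) ∧
          ((σ a = a ∧ σ b = b) ∨ (σ a = b ∧ σ b = a)) ∧
          ((σ c = c ∧ σ d = d) ∨ (σ c = d ∧ σ d = c)) := by
        intro σ hσ
        simp only [pball, Finset.mem_inter, Finset.mem_filter, Finset.mem_univ, true_and] at hσ
        have hσ2 : hdist σ τ ≤ r := by
          have := hσ.2; unfold hdist at this ⊢; simpa only [ne_comm] using this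
        have h2 := mem_two hτ hσ.1 hσ2
        refine ⟨hσ.1, hσ2, h2, ?_, ?_⟩
        · have e1 := h2 a; have e2 := h2 b
          have := σ.injective.ne hab
          grind
        · have e1 := h2 c; have e2 := h2 d
          have := σ.injective.ne hcd
          grind
      have sx : ∀ σ ∈ pball 1 r ∩ pball τ r, ∀ x, x ≠ a → x ≠ b → x ≠ c → x ≠ d →
          σ x ≠ a ∧ σ x ≠ b ∧ σ x ≠ c ∧ σ x ≠ d := by
        intro σ hσ x h1 h2 h3 h4
        have := tx x h1 h2 h3 h4
        rcases (key σ hσ).2.2.1 x with h | h <;> rw [h]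
        · exact ⟨h1, h2, h3, h4⟩
        · exact this
      apply Finset.card_le_card_of_injOn F
      · intro σ hσ
        obtain ⟨k1, k2, k3, k4, k5⟩ := key σ hσ
        have k6 := sx σ hσ
        simp only [pball, Finset.coe_inter, Set.mem_inter_iff, Finset.coe_filter,
          Finset.mem_univ, true_and, Set.mem_ofPred_eq]
        have hcomm : ∀ x y : Equiv.Perm (Fin n), hdist x y = hdist y x := by
          intro x y; unfold hdist; simp only [ne_comm]
        rw [hcomm (u * τ)]
        rcases k5 with ⟨c1, c2⟩ | ⟨c1, c2⟩
        · have hF : F σ = σ := by simp [F, c1]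
          rw [hF]
          refine ⟨k1, ?_⟩
          rcases k4 with ⟨c3, c4⟩ | ⟨c3, c4⟩
          · refine le_trans (hdist_le_of_perm (σ := σ) (τ := τ) 1 ?_) k2
            intro x hx
            rw [Equiv.Perm.one_apply]
            by_cases h1 : x = a
            · subst h1; grind
            by_cases h2 : x = b
            · subst h2; grind
            by_cases h3 : x = c
            · subst h3; grind
            by_cases h4 : x = d
            · subst h4; grind
            rwa [tx' x h1 h2 h3 h4] at hx
          · refine le_trans (hdist_le_of_perm (σ := σ) (τ := τ) (Equiv.swap b d) ?_) k2
            intro x hx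
            by_cases h1 : x = a
            · subst h1; grind
            by_cases h2 : x = b
            · subst h2; rw [Equiv.swap_apply_left]; grind
            by_cases h3 : x = c
            · subst h3; rw [Equiv.swap_apply_of_ne_of_ne hcb hcd]; grind
            by_cases h4 : x = d
            · subst h4; grind
            rw [Equiv.swap_apply_of_ne_of_ne h2 h4]
            rwa [tx' x h1 h2 h3 h4] at hx
        · have hc' : σ c ≠ c := by rw [c1]; exact hcd.symm
          rcases k4 with ⟨c3, c4⟩ | ⟨c3, c4⟩
          · have hF : F σ = v * σ := by simp [F, hc', c3]
            have wa : (v * σ) a = a := by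
              rw [Equiv.Perm.mul_apply, c3]; exact vx a hab hca.symm hda.symm
            have wb : (v * σ) b = c := by rw [Equiv.Perm.mul_apply, c4, vb]
            have wc : (v * σ) c = b := by rw [Equiv.Perm.mul_apply, c1, vd]
            have wd : (v * σ) d = d := by rw [Equiv.Perm.mul_apply, c2, vc]
            have wx : ∀ x, x ≠ a → x ≠ b → x ≠ c → x ≠ d → (v * σ) x = σ x := by
              intro x h1 h2 h3 h4
              obtain ⟨g1, g2, g3, g4⟩ := k6 x h1 h2 h3 h4
              rw [Equiv.Perm.mul_apply]; exact vx _ g2 g3 g4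
            rw [hF]
            constructor
            · refine le_trans (hdist_le_of_perm (σ := 1) (τ := σ) (Equiv.swap b d) ?_) k1
              intro x hx
              simp only [Equiv.Perm.one_apply] at hx ⊢
              by_cases h1 : x = a
              · subst h1; grind
              by_cases h2 : x = b
              · subst h2; rw [Equiv.swap_apply_left]; grind
              by_cases h3 : x = c
              · subst h3; rw [Equiv.swap_apply_of_ne_of_ne hcb hcd]; grind
              by_cases h4 : x = d
              · subst h4; grind
              rw [Equiv.swap_apply_of_ne_of_ne h2 h4]
              rwa [wx x h1 h2 h3 h4] at hx
            · refine le_trans (hdist_le_of_perm (σ := σ) (τ := τ) (Equiv.swap b c) ?_) k2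
              intro x hx
              by_cases h1 : x = a
              · subst h1; rw [Equiv.swap_apply_of_ne_of_ne hab hca.symm]; grind
              by_cases h2 : x = b
              · subst h2; grind
              by_cases h3 : x = c
              · subst h3; rw [Equiv.swap_apply_right]; grind
              by_cases h4 : x = d
              · subst h4; grind
              rw [Equiv.swap_apply_of_ne_of_ne h2 h3]
              rwa [wx x h1 h2 h3 h4, tx' x h1 h2 h3 h4] at hx
          · have hF : F σ = u * σ := by
              have : σ a ≠ a := by rw [c3]; exact hab.symm
              simp [F, hc', this]
            rw [hF, hdist_mul]
            refine ⟨?_, k2⟩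
            refine le_trans (hdist_le_of_perm (σ := 1) (τ := σ) 1 ?_) k1
            intro x hx
            simp only [Equiv.Perm.one_apply, Equiv.Perm.mul_apply] at hx ⊢
            by_cases h1 : x = a
            · subst h1; grind
            by_cases h2 : x = b
            · subst h2; grind
            by_cases h3 : x = c
            · subst h3; grind
            by_cases h4 : x = d
            · subst h4; grind
            obtain ⟨g1, g2, g3, g4⟩ := k6 x h1 h2 h3 h4
            rwa [ux _ g1 g3 g4] at hx
      · intro σ hσ σ' hσ' he
        obtain ⟨-, -, -, k4, k5⟩ := key σ hσ
        obtain ⟨-, -, -, k4', k5'⟩ := key σ' hσ'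
        have eb : F σ b = F σ' b := by rw [he]
        have ea : F σ a = F σ' a := by rw [he]
        have va : v a = a := vx a hab hca.symm hda.symm
        have ub : u b = b := ux b hab.symm hcb.symm hdb.symm
        simp only [F] at he ea eb
        split_ifs at he ea eb <;> try simp only [Equiv.Perm.mul_apply] at ea eb
        all_goals
          first
          | exact he
          | exact mul_left_cancel he
          | (exfalso; grind)
  · push Not at hinv
    obtain ⟨a, ha⟩ := hinv
    obtain ⟨b, hb⟩ : ∃ b, τ a = b := ⟨_, rfl⟩
    obtain ⟨c, hc⟩ : ∃ c, τ b = c := ⟨_, rfl⟩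
    have hca : c ≠ a := by rw [← hc, ← hb]; exact ha
    have hab : a ≠ b := by
      intro h; apply ha; rw [hb, ← h, hb, ← h]
    have hbc : b ≠ c := by
      intro h; apply hab; apply τ.injective; rw [hb, hc, h]
    let u : Equiv.Perm (Fin n) := Equiv.swap b c
    have ub : u b = c := Equiv.swap_apply_left _ _
    have uc : u c = b := Equiv.swap_apply_right _ _
    have ux : ∀ x, x ≠ b → x ≠ c → u x = x := fun x h1 h2 => Equiv.swap_apply_of_ne_of_ne h1 h2
    have tx : ∀ x, x ≠ a → x ≠ b → τ x ≠ b ∧ τ x ≠ c := by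
      intro x h1 h2
      rw [← hc]; nth_rewrite 1 [← hb]
      exact ⟨τ.injective.ne h1, τ.injective.ne h2⟩
    have ta' : (u * τ) a = c := by rw [Equiv.Perm.mul_apply, hb, ub]
    have tb' : (u * τ) b = b := by rw [Equiv.Perm.mul_apply, hc, uc]
    have tx' : ∀ x, x ≠ a → x ≠ b → (u * τ) x = τ x := by
      intro x h1 h2
      rw [Equiv.Perm.mul_apply]; exact ux _ (tx x h1 h2).1 (tx x h1 h2).2
    refine ⟨u * τ, ?_, ?_⟩
    · have := hdist_one_succ (τ := τ) (τ' := u * τ) b (by grind) (by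
        intro x
        by_cases h1 : x = a
        · subst h1; grind
        by_cases h2 : x = b
        · subst h2; grind
        rw [tx' x h1 h2]; tauto)
      omega
    · let F : Equiv.Perm (Fin n) → Equiv.Perm (Fin n) := fun σ =>
        if σ b = b then σ else u * σ
      have key : ∀ σ ∈ pball 1 r ∩ pball τ r, hdist 1 σ ≤ r ∧ hdist σ τ ≤ r ∧
          (∀ x, σ x = x ∨ σ x = τ x) ∧
          ((σ a = a ∧ σ b = b) ∨ (σ a = b ∧ σ b = c)) := by
        intro σ hσ
        simp only [pball, Finset.mem_inter, Finset.mem_filter, Finset.mem_univ, true_and] at hσ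
        have hσ2 : hdist σ τ ≤ r := by
          have := hσ.2; unfold hdist at this ⊢; simpa only [ne_comm] using this
        have h2 := mem_two hτ hσ.1 hσ2
        refine ⟨hσ.1, hσ2, h2, ?_⟩
        have e1 := h2 a; have e2 := h2 b
        have := σ.injective.ne hab
        obtain ⟨y, hy⟩ := σ.surjective b
        have e3 := h2 y
        have : y = a ∨ y = b := by
          rcases e3 with h | h
          · right; rw [← h, hy]
          · left; apply τ.injective; rw [← h, hy, hb]
        rcases this with rfl | rfl <;> grind
      apply Finset.card_le_card_of_injOn F
      · intro σ hσ
        obtain ⟨k1, k2, k3, k4⟩ := key σ hσ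
        simp only [pball, Finset.coe_inter, Set.mem_inter_iff, Finset.coe_filter,
          Finset.mem_univ, true_and, Set.mem_ofPred_eq]
        have hcomm : ∀ x y : Equiv.Perm (Fin n), hdist x y = hdist y x := by
          intro x y; unfold hdist; simp only [ne_comm]
        rw [hcomm (u * τ)]
        rcases k4 with ⟨c1, c2⟩ | ⟨c1, c2⟩
        · have hF : F σ = σ := by simp [F, c2]
          rw [hF]
          refine ⟨k1, le_trans (hdist_le_of_perm (σ := σ) (τ := τ) 1 ?_) k2⟩
          intro x hx
          rw [Equiv.Perm.one_apply]
          by_cases h1 : x = a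
          · subst h1; grind
          by_cases h2 : x = b
          · subst h2; grind
          rwa [tx' x h1 h2] at hx
        · have hF : F σ = u * σ := by
            have : σ b ≠ b := by rw [c2]; exact hbc.symm
            simp [F, this]
          rw [hF, hdist_mul]
          refine ⟨le_trans (hdist_le_of_perm (σ := 1) (τ := σ) 1 ?_) k1, k2⟩
          intro x hx
          simp only [Equiv.Perm.one_apply, Equiv.Perm.mul_apply] at hx ⊢
          by_cases h1 : x = a
          · subst h1; grind
          by_cases h2 : x = b
          · subst h2; grind
          intro h
          rw [← h] at hx
          by_cases h3 : x = c
          · subst h3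
            apply h2
            apply σ.injective; rw [← h, c2]
          · exact hx (ux x h2 h3).symm
      · intro σ hσ σ' hσ' he
        obtain ⟨-, -, -, k4⟩ := key σ hσ
        obtain ⟨-, -, -, k4'⟩ := key σ' hσ'
        have ea : F σ a = F σ' a := by rw [he]
        simp only [F] at he ea
        split_ifs at he ea <;> try simp only [Equiv.Perm.mul_apply] at ea
        all_goals
          first
          | exact he
          | exact mul_left_cancel he
          | (exfalso; grind)

theorem pball_inter_mul {n : ℕ} (u π τ : Equiv.Perm (Fin n)) (r : ℕ) :
    (pball (u * π) r ∩ pball (u * τ) r).card = (pball π r ∩ pball τ r).card := by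
  symm
  apply Finset.card_bij (fun σ _ => u * σ)
  · intro σ hσ
    simpa [pball, hdist_mul] using hσ
  · intro σ _ σ' _ h; exact mul_left_cancel h
  · intro σ hσ
    refine ⟨u⁻¹ * σ, ?_, by simp⟩
    simp only [pball, Finset.mem_inter, Finset.mem_filter, Finset.mem_univ, true_and] at hσ ⊢
    rw [← hdist_mul u π, ← hdist_mul u τ]
    simpa using hσ

theorem dom {n r : ℕ} (hr : 2 ≤ r)
    (hex : ∃ π τ : Equiv.Perm (Fin n), hdist π τ = 2 * r - 1) (π τ : Equiv.Perm (Fin n))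
    (h : 2 * r - 1 ≤ hdist π τ) :
    ∃ π' τ' : Equiv.Perm (Fin n), hdist π' τ' = 2 * r - 1 ∧
        (pball π r ∩ pball τ r).card ≤ (pball π' r ∩ pball τ' r).card := by
  rcases h.eq_or_lt with h | h
  · exact ⟨π, τ, h.symm, le_rfl⟩
  have e : hdist π τ = hdist 1 (π⁻¹ * τ) := by rw [← hdist_mul π⁻¹]; simp
  have e2 : (pball π r ∩ pball τ r).card = (pball 1 r ∩ pball (π⁻¹ * τ) r).card := by
    rw [← pball_inter_mul π⁻¹]; simp
  rw [e] at h
  rw [e2]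
  by_cases h2 : hdist 1 (π⁻¹ * τ) = 2 * r
  · obtain ⟨τ', h3, h4⟩ := dom_one _ h2 hr
    exact ⟨1, τ', h3, h4⟩
  · obtain ⟨π', τ', h3⟩ := hex
    refine ⟨π', τ', h3, ?_⟩
    have : pball 1 r ∩ pball (π⁻¹ * τ) r = ∅ := by
      apply Finset.eq_empty_of_forall_notMem
      intro σ hσ
      simp only [pball, Finset.mem_inter, Finset.mem_filter, Finset.mem_univ, true_and] at hσ
      have hσ2 : hdist σ (π⁻¹ * τ) ≤ r := by
        have := hσ.2; unfold hdist at this ⊢; simpa only [ne_comm] using this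
      have := hdist_tri σ (π⁻¹ * τ)
      omega
    rw [this]; simp

/-- Let `t ≥ 2`, `r = 2t` or `r = 2t + 1`, and `n ≥ 2r`. Then every pair
of permutations at distance `≥ 2r - 1` is dominated by a pair at distance exactly
`2r - 1`, i.e. `N(n, 2r-1, r) = I(n, 2r-1, r)`. Consequently
`N(n, 2r-1, r) ≥ N(n, 2r, r)` and
`N(n, 2r-1, r) ≥ 2·C(2t-3, t) + ℓ*·C(2t-2, t-1)`, where `ℓ* = 5` if `r = 2t` and
`ℓ* = 7` if `r = 2t + 1`. -/
theorem stmt18 (n t r : ℕ) (ht : 2 ≤ t) (hr : r = 2 * t ∨ r = 2 * t + 1)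
    (hn : 2 * r ≤ n) :
    (∀ π τ : Equiv.Perm (Fin n), 2 * r - 1 ≤ hdist π τ →
      ∃ π' τ' : Equiv.Perm (Fin n), hdist π' τ' = 2 * r - 1 ∧
        (pball π r ∩ pball τ r).card ≤ (pball π' r ∩ pball τ' r).card) ∧
    Nmax n (2 * r - 1) r = Imax n (2 * r - 1) r ∧
    Nmax n (2 * r) r ≤ Nmax n (2 * r - 1) r ∧
    2 * Nat.choose (2 * t - 3) t +
        (if r = 2 * t then 5 else 7) * Nat.choose (2 * t - 2) (t - 1) ≤
      Nmax n (2 * r - 1) r := by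
  obtain ⟨π₀, τ₀, h0, hlow⟩ := lower n t r ht hr hn
  have hdom := dom (n := n) (r := r) (by omega) ⟨π₀, τ₀, h0⟩
  refine ⟨hdom, ?_, ?_, ?_⟩
  · apply le_antisymm
    · apply Finset.sup_le
      rintro ⟨π, τ⟩ hp
      simp only [Finset.mem_filter, Finset.mem_univ, true_and] at hp
      obtain ⟨π', τ', h1, h2⟩ := hdom π τ hp
      refine le_trans h2 ?_
      exact Finset.le_sup
        (f := fun p : Equiv.Perm (Fin n) × Equiv.Perm (Fin n) => (pball p.1 r ∩ pball p.2 r).card)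
        (b := (π', τ')) (by simpa using h1)
    · apply Finset.sup_mono
      intro p hp
      simp only [Finset.mem_filter, Finset.mem_univ, true_and] at hp ⊢
      omega
  · apply Finset.sup_mono
    intro p hp
    simp only [Finset.mem_filter, Finset.mem_univ, true_and] at hp ⊢
    omega
  · refine le_trans hlow ?_
    exact Finset.le_sup
      (f := fun p : Equiv.Perm (Fin n) × Equiv.Perm (Fin n) => (pball p.1 r ∩ pball p.2 r).card)
      (b := (π₀, τ₀)) (by simp only [Finset.mem_filter, Finset.mem_univ, true_and]; omega)
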